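/- 2×2×2 Abalone is strongly solved: each of the 23 nonisomorphic constellations has outcome class exactly as follows — o(B0)=o(B4)=N; o(B1)=o(B2)=o(B3)=o(±B6)=o(±B9)=o(±B10)=o(±B13)=D; o(B5)=o(B7)=o(B8)=o(B12)=N-hat and their negatives are N-check; o(B11)=L and o(-B11)=R. -/

import Mathlib

/-- An abstract two-player game with perfect information and alternating moves.
`true` denotes Left (Black) and `false` denotes Right (Gray). -/
structure AGame (P : Type*) where
  /-- `move pl p q` : player `pl` has a legal move from position `p` to position `q`. -/
  move : Bool → P → P → Prop
  /-- `win pl p` : the position `p` is a terminal win for player `pl`. -/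
  win : Bool → P → Prop

namespace AGame

variable {P : Type*}

/-- `FW G pl turn p` : player `pl` can force a win (in finitely many moves)
from position `p` when it is `turn`'s move. -/
inductive FW (G : AGame P) (pl : Bool) : Bool → P → Prop
  | terminal (turn : Bool) (p : P) : G.win pl p → FW G pl turn p
  | self (p q : P) : ¬ G.win (!pl) p → G.move pl p q → FW G pl (!pl) q → FW G pl pl p
  | opp (p : P) : ¬ G.win (!pl) p → (∃ q, G.move (!pl) p q) →
      (∀ q, G.move (!pl) p q → FW G pl pl q) → FW G pl (!pl) p

/-- Outcome class `L` : Left (Black) always wins, whoever moves first. -/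
def OutL (G : AGame P) (p : P) : Prop := G.FW true true p ∧ G.FW true false p

/-- Outcome class `R` : Right (Gray) always wins, whoever moves first. -/
def OutR (G : AGame P) (p : P) : Prop := G.FW false false p ∧ G.FW false true p

/-- Outcome class `N` : whoever moves next wins. -/
def OutN (G : AGame P) (p : P) : Prop := G.FW true true p ∧ G.FW false false p

/-- Outcome class `D` : neither player can force a win (optimal play is an infinite draw). -/
def OutD (G : AGame P) (p : P) : Prop :=
  ¬ G.FW true true p ∧ ¬ G.FW true false p ∧ ¬ G.FW false true p ∧ ¬ G.FW false false p

/-- Outcome class `N̂` : Left wins moving first, and the game is a draw if Right moves first. -/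
def OutNhat (G : AGame P) (p : P) : Prop :=
  G.FW true true p ∧ ¬ G.FW true false p ∧ ¬ G.FW false false p

/-- Outcome class `Ň` : Right wins moving first, and the game is a draw if Left moves first. -/
def OutNcheck (G : AGame P) (p : P) : Prop :=
  G.FW false false p ∧ ¬ G.FW false true p ∧ ¬ G.FW true true p

end AGame

namespace Abalone

/-- A board cell, in axial hexagonal coordinates `(q, r)` where `q` is the column. -/
abbrev Cell : Type := ℤ × ℤ

/-- A constellation: each cell carries a black marble (`some true`),
a gray marble (`some false`), or is empty (`none`). -/
abbrev Pos : Type := Cell → Option Bool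

/-- The six unit directions of the hexagonal grid. -/
def dirs : List Cell := [(1, 0), (0, 1), (-1, 1), (-1, 0), (0, -1), (1, -1)]

/-- Add a direction to a cell. -/
def addc (x d : Cell) : Cell := (x.1 + d.1, x.2 + d.2)

/-- The cell `n` steps from `x` in direction `d`. -/
def stepc (x : Cell) (n : ℕ) (d : Cell) : Cell := (x.1 + (n : ℤ) * d.1, x.2 + (n : ℤ) * d.2)

/-- The opposite direction. -/
def negd (d : Cell) : Cell := (-d.1, -d.2)

open Classical in
/-- The result of shifting the line of `len` marbles starting one step after `x`
(in direction `d`, with the marble at `x` itself moving into the vacated space):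
cell `x` is vacated, each cell `x + i·d` (`1 ≤ i ≤ len`) receives the content of its
predecessor, and marbles shifted off the board are removed. -/
noncomputable def shiftResult (board : Finset Cell) (c : Pos) (x d : Cell) (len : ℕ) : Pos :=
  fun y =>
    if y ∉ board then none
    else if y = x then none
    else if ∃ i : ℕ, 1 ≤ i ∧ i ≤ len ∧ y = stepc x i d then c (addc y (negd d))
    else c y

/-- In-line movement (including sumito pushes): player `pl` moves a line of `k` of their
own contiguous marbles (`1 ≤ k ≤ maxG`) one step in the line's direction `d`, possibly
pushing a strictly shorter opposing line of `m < k` marbles, the leading opposing marble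
being pushed either onto an empty board cell or off the board. -/
def InlineMove (board : Finset Cell) (maxG : ℕ) (pl : Bool) (c c' : Pos) : Prop :=
  ∃ x d, d ∈ dirs ∧ ∃ k m : ℕ,
    1 ≤ k ∧ k ≤ maxG ∧ m < k ∧
    (∀ i < k, stepc x i d ∈ board ∧ c (stepc x i d) = some pl) ∧
    (∀ i, k ≤ i → i < k + m → stepc x i d ∈ board ∧ c (stepc x i d) = some (!pl)) ∧
    ((m = 0 ∧ stepc x k d ∈ board ∧ c (stepc x k d) = none) ∨
      (1 ≤ m ∧ (stepc x (k + m) d ∉ board ∨ c (stepc x (k + m) d) = none))) ∧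
    c' = shiftResult board c x d (k + m)

open Classical in
/-- The result of a broadside move: the `k` marbles at `x + i·d` (`i < k`) each move
one step in direction `e`. -/
noncomputable def broadResult (c : Pos) (pl : Bool) (x d e : Cell) (k : ℕ) : Pos :=
  fun y =>
    if ∃ i < k, y = stepc x i d then none
    else if ∃ i < k, y = addc (stepc x i d) e then some pl
    else c y

/-- Broadside movement: player `pl` moves a line of `k` of their own contiguous marbles
(`1 ≤ k ≤ maxG`, the line in direction `d`) one step in a direction `e` not along the
line, each marble landing on an empty board cell. -/
def BroadsideMove (board : Finset Cell) (maxG : ℕ) (pl : Bool) (c c' : Pos) : Prop :=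
  ∃ x d e, d ∈ dirs ∧ e ∈ dirs ∧ e ≠ d ∧ e ≠ negd d ∧ ∃ k : ℕ,
    1 ≤ k ∧ k ≤ maxG ∧
    (∀ i < k, stepc x i d ∈ board ∧ c (stepc x i d) = some pl) ∧
    (∀ i < k, addc (stepc x i d) e ∈ board ∧ c (addc (stepc x i d) e) = none) ∧
    c' = broadResult c pl x d e k

/-- A legal Abalone move for player `pl`. -/
def Move (board : Finset Cell) (maxG : ℕ) (pl : Bool) (c c' : Pos) : Prop :=
  InlineMove board maxG pl c c' ∨ BroadsideMove board maxG pl c c'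

/-- The number of marbles of player `pl` on the board. -/
def countM (board : Finset Cell) (pl : Bool) (c : Pos) : ℕ :=
  (board.filter (fun y => c y = some pl)).card

/-- Player `pl` has won: the opponent has fewer than `n` marbles left,
i.e. at least one opposing marble has been pushed off the board. -/
def Wins (board : Finset Cell) (n : ℕ) (pl : Bool) (c : Pos) : Prop :=
  countM board (!pl) c < n

/-- The negative of a constellation: swap black and gray marbles. -/
def negP (c : Pos) : Pos := fun y => (c y).map (fun b => !b)

end Abalone

namespace Abalone

/-! ### The 2×2×2 Abalone board

A hexagonal grid of 7 cells (columns of sizes 2, 3, 2). In axial coordinates, the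
left column is `lt = (-1,0)` (top), `lb = (-1,1)` (bottom); the middle column is
`mt = (0,-1)`, `mm = (0,0)`, `mb = (0,1)`; the right column is `rt = (1,-1)`,
`rb = (1,0)`. Each player has 2 marbles, may move 1–2 contiguous marbles, a 2-line
may push 1 opposing marble, and a player wins by ejecting one opposing marble. -/

def lt : Cell := (-1, 0)
def lb : Cell := (-1, 1)
def mt : Cell := (0, -1)
def mm : Cell := (0, 0)
def mb : Cell := (0, 1)
def rt : Cell := (1, -1)
def rb : Cell := (1, 0)

def board222 : Finset Cell := {lt, lb, mt, mm, mb, rt, rb}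

/-- 2×2×2 Abalone as a game: moves of 1–2 contiguous marbles, win by
reducing the opponent to fewer than 2 marbles. -/
def G222 : AGame Pos :=
  { move := Move board222 2
    win := Wins board222 2 }

/-- The constellation with black marbles on `b1, b2` and gray marbles on `g1, g2`. -/
def mk2 (b1 b2 g1 g2 : Cell) : Pos := fun y =>
  if y = b1 ∨ y = b2 then some true
  else if y = g1 ∨ y = g2 then some false
  else none

/-- The 14 boards `B0`–`B13` of the paper (Figure 4). -/
def B0 : Pos := mk2 lt lb rt rb
def B1 : Pos := mk2 lt rb lb rt
def B2 : Pos := mk2 lt rt lb rb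
def B3 : Pos := mk2 lt mb lb mt
def B4 : Pos := mk2 lt mt lb mb
def B5 : Pos := mk2 mt mb lt lb
def B6 : Pos := mk2 lt rb lb mt
def B7 : Pos := mk2 rb mt lt lb
def B8 : Pos := mk2 lt mm mb rb
def B9 : Pos := mk2 lt mm mb rt
def B10 : Pos := mk2 lt mm lb rt
def B11 : Pos := mk2 lt mm lb mb
def B12 : Pos := mk2 lt mm lb rb
def B13 : Pos := mk2 lt mm lb mt

end Abalone

namespace Abalone

/-- The cells of the board, as a list. -/
def cells : List Cell := [lt, lb, mt, mm, mb, rt, rb]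

lemma mem_board222 (y : Cell) : y ∈ board222 ↔ y ∈ cells := by
  simp [board222, cells]

/-- The number of marbles of player `pl`, computed along the list of cells. -/
def count (pl : Bool) (c : Pos) : ℕ := cells.countP fun y => c y = some pl

lemma countM_board222 (pl : Bool) (c : Pos) : countM board222 pl c = count pl c := by
  have h : board222 = cells.toFinset := by decide
  have hn : cells.Nodup := by decide
  have hf : cells.toFinset.filter (fun y => c y = some pl) =
      (cells.filter fun y => c y = some pl).toFinset := by
    ext; simp
  rw [countM, count, h, hf, List.toFinset_card_of_nodup (hn.filter _),
    List.countP_eq_length_filter]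

lemma wins_iff (pl : Bool) (c : Pos) : G222.win pl c ↔ count (!pl) c < 2 := by
  rw [← countM_board222]; rfl

/-- A computable form of `shiftResult board222`. -/
def slide (c : Pos) (x d : Cell) (len : ℕ) : Pos := fun y =>
  if y ∉ cells then none
  else if y = x then none
  else if ∃ i < len, y = stepc x (i + 1) d then c (addc y (negd d))
  else c y

lemma shiftResult_board222 (c : Pos) (x d : Cell) (len : ℕ) :
    shiftResult board222 c x d len = slide c x d len := by
  funext y
  have h : (∃ i : ℕ, 1 ≤ i ∧ i ≤ len ∧ y = stepc x i d) ↔ ∃ i < len, y = stepc x (i + 1) d := by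
    constructor
    · rintro ⟨i, h1, h2, h3⟩
      exact ⟨i - 1, by omega, by rwa [Nat.sub_add_cancel h1]⟩
    · rintro ⟨i, h1, h2⟩
      exact ⟨i + 1, by omega, by omega, h2⟩
  simp only [shiftResult, slide, mem_board222, h]

/-- A computable form of `broadResult`. -/
def sidestep (c : Pos) (pl : Bool) (x d e : Cell) (k : ℕ) : Pos := fun y =>
  if ∃ i < k, y = stepc x i d then none
  else if ∃ i < k, y = addc (stepc x i d) e then some pl
  else c y

lemma broadResult_eq (c : Pos) (pl : Bool) (x d e : Cell) (k : ℕ) :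
    broadResult c pl x d e k = sidestep c pl x d e k := by
  funext y
  simp only [broadResult, sidestep]

/-- No marble lies off the board. -/
def Supported (c : Pos) : Prop := ∀ y, y ∉ cells → c y = none

lemma Supported.of_move {pl : Bool} {c c' : Pos} (hc : Supported c) (h : G222.move pl c c') :
    Supported c' := by
  intro y hy
  rcases h with ⟨x, d, -, k, m, -, -, -, -, -, -, rfl⟩ | ⟨x, d, e, -, -, -, -, k, -, -, -, h, rfl⟩
  · rw [shiftResult_board222, slide, if_pos hy]
  · have hn : ¬ ∃ i < k, y = addc (stepc x i d) e := by
      rintro ⟨i, hi, rfl⟩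
      exact hy ((mem_board222 _).1 (h i hi).1)
    rw [broadResult_eq, sidestep, if_neg hn, hc y hy, ite_self]

/-- A broadside move of a single marble is also an in-line move. -/
lemma Supported.sidestep_one {pl : Bool} {c : Pos} {x e : Cell} (hc : Supported c) (d : Cell)
    (hpl : c x = some pl) (he : addc x e ∈ cells) :
    sidestep c pl x d e 1 = slide c x e 1 := by
  have h0 : stepc x 0 d = x := by simp [stepc]
  have h1 : stepc x 1 e = addc x e := by simp [stepc, addc]
  have h2 : addc (addc x e) (negd e) = x := by simp [addc, negd]
  funext y
  simp only [sidestep, slide, Nat.lt_one_iff, exists_eq_left, h0, Nat.zero_add, h1]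
  by_cases hyx : y = x
  · simp [hyx]
  by_cases hye : y = addc x e
  · subst hye
    simp [hyx, he, h2, hpl]
  by_cases hy : y ∈ cells
  · simp [hyx, hye, hy]
  · simp [hyx, hye, hy, hc y hy]

/-- Player `pl` has a line of `k` marbles starting at `x` in direction `d`. -/
abbrev IsLine (pl : Bool) (c : Pos) (x d : Cell) (k : ℕ) : Prop :=
  ∀ i < k, stepc x i d ∈ cells ∧ c (stepc x i d) = some pl

/-- The translate in direction `e` of the line of `k` cells starting at `x` in direction `d` is
vacant. -/
abbrev IsVacant (c : Pos) (x d e : Cell) (k : ℕ) : Prop :=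
  ∀ i < k, addc (stepc x i d) e ∈ cells ∧ c (addc (stepc x i d) e) = none

/-- The legality condition for in-line moves. -/
abbrev InlineLegal (pl : Bool) (c : Pos) (x d : Cell) (k m : ℕ) : Prop :=
  IsLine pl c x d k ∧
    (∀ i, k ≤ i → i < k + m → stepc x i d ∈ cells ∧ c (stepc x i d) = some (!pl)) ∧
    ((m = 0 ∧ stepc x k d ∈ cells ∧ c (stepc x k d) = none) ∨
      (1 ≤ m ∧ (stepc x (k + m) d ∉ cells ∨ c (stepc x (k + m) d) = none)))

/-- The positions reachable by a move of player `pl`; broadside moves of a single marble are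
omitted, since they are in-line moves. -/
def moves (pl : Bool) (c : Pos) : List Pos :=
  (cells.filter fun x => c x = some pl).flatMap fun x => dirs.flatMap fun d =>
    ([(1, 0), (2, 0), (2, 1)].flatMap fun km : ℕ × ℕ =>
      if InlineLegal pl c x d km.1 km.2 then [slide c x d (km.1 + km.2)] else []) ++
    (if IsLine pl c x d 2 then
      dirs.flatMap fun e =>
        if (e ≠ d ∧ e ≠ negd d) ∧ IsVacant c x d e 2 then [sidestep c pl x d e 2] else []
    else [])

lemma move_of_mem_moves {pl : Bool} {c c' : Pos} (h : c' ∈ moves pl c) : G222.move pl c c' := by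
  simp only [moves, List.mem_flatMap, List.mem_filter, List.mem_append, List.mem_ite_nil_right,
    List.mem_singleton, decide_eq_true_eq] at h
  obtain ⟨x, -, d, hd, ⟨⟨k, m⟩, hkm, hl, rfl⟩ | ⟨hx, e, he, ⟨hed, hl⟩, rfl⟩⟩ := h
  · left
    simp only [List.mem_cons, Prod.mk.injEq, List.not_mem_nil, or_false] at hkm
    refine ⟨x, d, hd, k, m, by omega, by omega, by omega, ?_⟩
    simpa only [mem_board222, shiftResult_board222, and_true, and_assoc] using hl
  · right
    refine ⟨x, d, e, hd, he, hed.1, hed.2, 2, by omega, by omega, ?_⟩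
    simpa only [mem_board222, broadResult_eq, and_true] using ⟨hx, hl⟩

lemma Supported.mem_moves {pl : Bool} {c c' : Pos} (hc : Supported c) (h : G222.move pl c c') :
    c' ∈ moves pl c := by
  have step_zero (x d : Cell) : stepc x 0 d = x := by simp [stepc]
  simp only [moves, List.mem_flatMap, List.mem_filter, List.mem_append, List.mem_ite_nil_right,
    List.mem_singleton, decide_eq_true_eq]
  rcases h with ⟨x, d, hd, k, m, hk, hk2, hm, h⟩ | ⟨x, d, e, hd, he, hed, hed', k, hk, hk2, h⟩
  · simp only [mem_board222, shiftResult_board222] at h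
    obtain ⟨h1, h2, h3, rfl⟩ := h
    have hx := h1 0 hk
    rw [step_zero] at hx
    refine ⟨x, hx, d, hd, .inl ⟨(k, m), ?_, ⟨h1, h2, h3⟩, rfl⟩⟩
    simp only [List.mem_cons, Prod.mk.injEq, List.not_mem_nil, or_false]
    omega
  · simp only [mem_board222, broadResult_eq] at h
    obtain ⟨h3, h4, rfl⟩ := h
    have hx := h3 0 hk
    have hxe := h4 0 hk
    rw [step_zero] at hx hxe
    obtain rfl | rfl : k = 1 ∨ k = 2 := by omega
    · refine ⟨x, hx, e, he, .inl ⟨(1, 0), by simp, ?_, hc.sidestep_one d hx.2 hxe.1⟩⟩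
      have h1 : stepc x 1 e = addc x e := by simp [stepc, addc]
      refine ⟨fun i hi => ?_, fun i h1 h2 => by omega, .inl ⟨rfl, by rwa [h1]⟩⟩
      rwa [Nat.lt_one_iff.1 hi, step_zero]
    · exact ⟨x, hx, d, hd, .inr ⟨h3, e, he, ⟨⟨hed, hed'⟩, h4⟩, rfl⟩⟩

/-- The constellation with the given cell contents. -/
def ofContents (a b c d e f g : Option Bool) : Pos := fun y =>
  if y = lt then a else if y = lb then b else if y = mt then c else if y = mm then d
  else if y = mb then e else if y = rt then f else if y = rb then g else none

lemma Supported.eq_ofContents {c : Pos} (hc : Supported c) :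
    c = ofContents (c lt) (c lb) (c mt) (c mm) (c mb) (c rt) (c rb) := by
  funext y
  unfold ofContents
  split_ifs with h1 h2 h3 h4 h5 h6 h7
  all_goals first
    | subst y; rfl
    | exact hc y (by simp [cells, *])

/-- No marble of either player has been ejected. -/
abbrev Full (c : Pos) : Prop := count true c = 2 ∧ count false c = 2

/-- The rotation of the board by a sixth of a turn. -/
def rot (x : Cell) : Cell := (x.1 + x.2, -x.1)

/-- The inverse of `rot`. -/
def rotInv (x : Cell) : Cell := (-x.2, x.1 + x.2)

/-- The positions isomorphic to `B11`, with player `pl` in the role of Black: `pl` holds the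
centre and a rim cell, and the opponent holds the next two rim cells in one of the two
directions. -/
abbrev Dominates (pl : Bool) (c : Pos) : Prop :=
  c mm = some pl ∧ ∃ x ∈ dirs, c x = some pl ∧
    ((c (rot x) = some (!pl) ∧ c (rot (rot x)) = some (!pl)) ∨
      (c (rotInv x) = some (!pl) ∧ c (rotInv (rotInv x)) = some (!pl)))

/-- Player `pl` can eject a marble or reach a dominating position in one move. -/
abbrev Threatens (pl : Bool) (c : Pos) : Prop :=
  ∃ q ∈ moves pl c, count (!pl) q < 2 ∨ Dominates pl q

/-- The facts about a single position that the analysis of the game rests on. -/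
def LocallySound (pl : Bool) (c : Pos) : Prop :=
  (∀ q ∈ moves pl c, Full q ∨ (count (!pl) q < 2 ∧ ¬ count pl q < 2)) ∧
  if Dominates pl c then
    0 < (moves (!pl) c).length ∧
      ∀ q ∈ moves (!pl) c, ¬ count pl q < 2 ∧ ∃ r ∈ moves pl q, count (!pl) r < 2
  else ∃ q ∈ moves (!pl) c, count pl q < 2 ∨ ¬ Threatens pl q

instance (pl : Bool) (c : Pos) : Decidable (LocallySound pl c) := by
  unfold LocallySound; infer_instance

lemma locallySound_ofContents : ∀ a b c d e f g : Option Bool,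
    Full (ofContents a b c d e f g) → ∀ pl, LocallySound pl (ofContents a b c d e f g) := by
  decide +kernel

lemma locallySound {c : Pos} (hs : Supported c) (hf : Full c) (pl : Bool) : LocallySound pl c := by
  rw [hs.eq_ofContents] at hf ⊢
  exact locallySound_ofContents _ _ _ _ _ _ _ hf pl

lemma Full.not_win {c : Pos} (hf : Full c) (pl : Bool) : ¬ G222.win pl c := by
  rw [wins_iff]
  obtain ⟨h1, h2⟩ := hf
  cases pl <;> simp only [Bool.not_true, Bool.not_false] <;> omega

lemma fw_of_dominates {pl : Bool} {c : Pos} (hs : Supported c) (hf : Full c)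
    (hd : Dominates pl c) : G222.FW pl (!pl) c := by
  have h := (locallySound hs hf pl).2
  rw [if_pos hd] at h
  obtain ⟨q, hq⟩ := List.exists_mem_of_length_pos h.1
  refine .opp c (hf.not_win _) ⟨q, move_of_mem_moves hq⟩ fun q hq => ?_
  obtain ⟨hw, r, hr, hrw⟩ := h.2 q (hs.mem_moves hq)
  refine .self q r ?_ (move_of_mem_moves hr) (.terminal _ _ ((wins_iff _ _).2 hrw))
  rwa [wins_iff, Bool.not_not]

lemma fw_of_threatens {pl : Bool} {c : Pos} (hs : Supported c) (hf : Full c)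
    (ht : Threatens pl c) : G222.FW pl pl c := by
  obtain ⟨q, hq, hw⟩ := ht
  refine .self c q (hf.not_win _) (move_of_mem_moves hq) ?_
  by_cases hqw : count (!pl) q < 2
  · exact .terminal _ _ ((wins_iff _ _).2 hqw)
  · have hqf : Full q := ((locallySound hs hf pl).1 q hq).resolve_right fun h => hqw h.1
    exact fw_of_dominates (hs.of_move (move_of_mem_moves hq)) hqf (hw.resolve_left hqw)

lemma threatens_or_dominates_of_fw {pl turn : Bool} {c : Pos} (h : G222.FW pl turn c) :
    G222.win pl c ∨ (¬ G222.win (!pl) c ∧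
      (Supported c → Full c → if turn = pl then Threatens pl c else Dominates pl c)) := by
  induction h with
  | terminal turn p hw => exact .inl hw
  | self p q hw hm _ ih =>
    refine .inr ⟨hw, fun hs hf => ?_⟩
    rw [if_pos rfl]
    refine ⟨q, hs.mem_moves hm, ?_⟩
    by_cases hqw : count (!pl) q < 2
    · exact .inl hqw
    · have hqf : Full q :=
        ((locallySound hs hf pl).1 q (hs.mem_moves hm)).resolve_right fun h => hqw h.1
      rw [wins_iff] at ih
      have h := (ih.resolve_left hqw).2 (hs.of_move hm) hqf
      rw [if_neg (by simp)] at h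
      exact .inr h
  | opp p hw _ _ ih =>
    refine .inr ⟨hw, fun hs hf => ?_⟩
    rw [if_neg (by simp)]
    by_contra hd
    have h := (locallySound hs hf pl).2
    rw [if_neg hd] at h
    obtain ⟨q, hq, hqt⟩ := h
    have hqn := (locallySound hs hf (!pl)).1 q hq
    have hi := ih q (move_of_mem_moves hq)
    rw [wins_iff, wins_iff] at hi
    rw [Bool.not_not] at hi hqn
    rcases hqn with hqf | ⟨hql, hqp⟩
    · have hql : ∀ b, ¬ count b q < 2 := fun b => by
        obtain ⟨h1, h2⟩ := hqf
        cases b <;> omega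
      have hit := (hi.resolve_left (hql _)).2 (hs.of_move (move_of_mem_moves hq)) hqf
      rw [if_pos rfl] at hit
      exact (hqt.resolve_left (hql _)) hit
    · exact (hi.resolve_left hqp).1 hql

/-- The player to move can force a win exactly if there is a threat. -/
theorem fw_self_iff {c : Pos} (hs : Supported c) (hf : Full c) (pl : Bool) :
    G222.FW pl pl c ↔ Threatens pl c := by
  refine ⟨fun h => ?_, fw_of_threatens hs hf⟩
  have h := ((threatens_or_dominates_of_fw h).resolve_left (hf.not_win _)).2 hs hf
  rwa [if_pos rfl] at h

/-- The player not to move can force a win exactly in the positions isomorphic to `±B11`. -/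
theorem fw_opp_iff {c : Pos} (hs : Supported c) (hf : Full c) (pl : Bool) :
    G222.FW pl (!pl) c ↔ Dominates pl c := by
  refine ⟨fun h => ?_, fw_of_dominates hs hf⟩
  have h := ((threatens_or_dominates_of_fw h).resolve_left (hf.not_win _)).2 hs hf
  rwa [if_neg (by simp)] at h

lemma supported_mk2 {b₁ b₂ g₁ g₂ : Cell}
    (h : b₁ ∈ cells ∧ b₂ ∈ cells ∧ g₁ ∈ cells ∧ g₂ ∈ cells) : Supported (mk2 b₁ b₂ g₁ g₂) := by
  obtain ⟨h1, h2, h3, h4⟩ := h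
  intro y hy
  have hne {x : Cell} (hx : x ∈ cells) : y ≠ x := fun h => hy (h ▸ hx)
  simp [mk2, hne h1, hne h2, hne h3, hne h4]

lemma Supported.negP {c : Pos} (hc : Supported c) : Supported (negP c) := fun y hy => by
  simp [Abalone.negP, hc y hy]

/-- Both players still have all their marbles, and these lie on the board. -/
structure Intact (c : Pos) : Prop where
  supported : Supported c
  full : Full c

lemma Intact.outN {c : Pos} (hc : Intact c) (h : Threatens true c ∧ Threatens false c) :
    G222.OutN c :=
  ⟨(fw_self_iff hc.1 hc.2 true).2 h.1, (fw_self_iff hc.1 hc.2 false).2 h.2⟩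

lemma Intact.outD {c : Pos} (hc : Intact c) (h : ¬ Threatens true c ∧ ¬ Dominates true c ∧
    ¬ Dominates false c ∧ ¬ Threatens false c) : G222.OutD c :=
  ⟨_root_.mt (fw_self_iff hc.1 hc.2 true).1 h.1, _root_.mt (fw_opp_iff hc.1 hc.2 true).1 h.2.1,
    _root_.mt (fw_opp_iff hc.1 hc.2 false).1 h.2.2.1, _root_.mt (fw_self_iff hc.1 hc.2 false).1 h.2.2.2⟩

lemma Intact.outNhat {c : Pos} (hc : Intact c)
    (h : Threatens true c ∧ ¬ Dominates true c ∧ ¬ Threatens false c) : G222.OutNhat c :=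
  ⟨(fw_self_iff hc.1 hc.2 true).2 h.1, _root_.mt (fw_opp_iff hc.1 hc.2 true).1 h.2.1,
    _root_.mt (fw_self_iff hc.1 hc.2 false).1 h.2.2⟩

lemma Intact.outNcheck {c : Pos} (hc : Intact c)
    (h : Threatens false c ∧ ¬ Dominates false c ∧ ¬ Threatens true c) : G222.OutNcheck c :=
  ⟨(fw_self_iff hc.1 hc.2 false).2 h.1, _root_.mt (fw_opp_iff hc.1 hc.2 false).1 h.2.1,
    _root_.mt (fw_self_iff hc.1 hc.2 true).1 h.2.2⟩

lemma Intact.outL {c : Pos} (hc : Intact c) (h : Threatens true c ∧ Dominates true c) :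
    G222.OutL c :=
  ⟨(fw_self_iff hc.1 hc.2 true).2 h.1, (fw_opp_iff hc.1 hc.2 true).2 h.2⟩

lemma Intact.outR {c : Pos} (hc : Intact c) (h : Threatens false c ∧ Dominates false c) :
    G222.OutR c :=
  ⟨(fw_self_iff hc.1 hc.2 false).2 h.1, (fw_opp_iff hc.1 hc.2 false).2 h.2⟩

end Abalone

open Abalone AGame in
/-- 2×2×2 Abalone is strongly solved. The outcome classes of the 23
nonisomorphic constellations are: `o(B0) = o(B4) = N`;
`o(B1) = o(B2) = o(B3) = o(±B6) = o(±B9) = o(±B10) = o(±B13) = D`;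
`o(B5) = o(B7) = o(B8) = o(B12) = N̂` and their negatives are `Ň`;
`o(B11) = L` and `o(-B11) = R`. -/
theorem abalone222_strongly_solved :
    G222.OutN B0 ∧ G222.OutN B4 ∧
    G222.OutD B1 ∧ G222.OutD B2 ∧ G222.OutD B3 ∧
    G222.OutD B6 ∧ G222.OutD (negP B6) ∧
    G222.OutD B9 ∧ G222.OutD (negP B9) ∧
    G222.OutD B10 ∧ G222.OutD (negP B10) ∧
    G222.OutD B13 ∧ G222.OutD (negP B13) ∧
    G222.OutNhat B5 ∧ G222.OutNcheck (negP B5) ∧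
    G222.OutNhat B7 ∧ G222.OutNcheck (negP B7) ∧
    G222.OutNhat B8 ∧ G222.OutNcheck (negP B8) ∧
    G222.OutNhat B12 ∧ G222.OutNcheck (negP B12) ∧
    G222.OutL B11 ∧ G222.OutR (negP B11) := by
  refine ⟨Intact.outN ?_ ?_, Intact.outN ?_ ?_,
    Intact.outD ?_ ?_, Intact.outD ?_ ?_, Intact.outD ?_ ?_,
    Intact.outD ?_ ?_, Intact.outD ?_ ?_, Intact.outD ?_ ?_, Intact.outD ?_ ?_,
    Intact.outD ?_ ?_, Intact.outD ?_ ?_, Intact.outD ?_ ?_, Intact.outD ?_ ?_,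
    Intact.outNhat ?_ ?_, Intact.outNcheck ?_ ?_, Intact.outNhat ?_ ?_, Intact.outNcheck ?_ ?_,
    Intact.outNhat ?_ ?_, Intact.outNcheck ?_ ?_, Intact.outNhat ?_ ?_, Intact.outNcheck ?_ ?_,
    Intact.outL ?_ ?_, Intact.outR ?_ ?_⟩
  all_goals first
    | exact ⟨supported_mk2 (by decide), by decide +kernel⟩
    | exact ⟨(supported_mk2 (by decide)).negP, by decide +kernel⟩
    | decide +kernel
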